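/- Let w be a weight, p > 0, and suppose the weak Fefferman–Stein inequality ‖f‖_{L^{p,∞}(w)} ≤ C‖f^{#}‖_{L^p(w)} holds for all f in the class S₀. Then for every bounded measurable set E of positive measure and every λ ∈ (0,1), w(E) ≤ C'/(log(1/λ))^p · ∫(Mχ_{{Mχ_E ≥ λ/(2·9^n)}})^p w. -/

import Mathlib

open MeasureTheory Metric Set Bornology
open scoped ENNReal

/-- The uncentered Hardy–Littlewood maximal operator over cubes (= closed balls in the
sup metric on `ℝⁿ = Fin n → ℝ`), acting on `ℝ≥0∞`-valued functions. -/
noncomputable def maximal {n : ℕ} (f : (Fin n → ℝ) → ℝ≥0∞) (x : Fin n → ℝ) : ℝ≥0∞ :=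
  ⨆ (c : Fin n → ℝ) (r : ℝ) (_ : 0 < r) (_ : x ∈ closedBall c r),
    (volume (closedBall c r))⁻¹ * ∫⁻ y in closedBall c r, f y

/-- `Mχ_E`, the maximal function of the indicator of a set `E`. -/
noncomputable def maximalInd {n : ℕ} (E : Set (Fin n → ℝ)) (x : Fin n → ℝ) : ℝ≥0∞ :=
  maximal (E.indicator 1) x

/-- The Fefferman–Stein sharp maximal function
`f^#(x) = sup_{Q∋x} (1/|Q|)∫_Q |f − f_Q|`. -/
noncomputable def sharpMax {n : ℕ} (f : (Fin n → ℝ) → ℝ) (x : Fin n → ℝ) : ℝ≥0∞ :=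
  ⨆ (c : Fin n → ℝ) (r : ℝ) (_ : 0 < r) (_ : x ∈ closedBall c r),
    (volume (closedBall c r))⁻¹ *
      ∫⁻ y in closedBall c r, (‖f y - ⨍ z in closedBall c r, f z‖₊ : ℝ≥0∞)

section CubeMaximal

open Filter Topology

variable {n : ℕ}

lemma volume_closedBall_mul (c c' : Fin n → ℝ) {k r : ℝ} (hk : 0 ≤ k) (hr : 0 ≤ r) :
    volume (closedBall c (k * r)) = ENNReal.ofReal (k ^ n) * volume (closedBall c' r) := by
  rw [Real.volume_pi_closedBall _ (by positivity), Real.volume_pi_closedBall _ hr,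
    ← ENNReal.ofReal_mul (by positivity), Fintype.card_fin, ← mul_pow]
  congr 2
  ring

lemma volume_closedBall_ne_zero (c : Fin n → ℝ) {r : ℝ} (hr : 0 < r) :
    volume (closedBall c r) ≠ 0 :=
  (measure_closedBall_pos volume c hr).ne'

lemma volume_closedBall_ne_top (c : Fin n → ℝ) (r : ℝ) :
    volume (closedBall c r) ≠ ∞ :=
  measure_closedBall_lt_top.ne

lemma le_volume_mul_maximalInd {A : Set (Fin n → ℝ)} (hA : MeasurableSet A) {x c : Fin n → ℝ}
    {r : ℝ} (hr : 0 < r) (hx : x ∈ closedBall c r) :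
    volume (A ∩ closedBall c r) ≤ maximalInd A x * volume (closedBall c r) := by
  have h : (volume (closedBall c r))⁻¹ * ∫⁻ y in closedBall c r, A.indicator 1 y
      ≤ maximalInd A x := by
    unfold maximalInd maximal
    exact le_iSup₂_of_le c r (le_iSup₂_of_le hr hx le_rfl)
  rw [lintegral_indicator_one hA, Measure.restrict_apply hA, mul_comm, ← div_eq_mul_inv] at h
  exact (ENNReal.div_le_iff (volume_closedBall_ne_zero c hr)
    (volume_closedBall_ne_top c r)).1 h

lemma lt_maximalInd_iff {A : Set (Fin n → ℝ)} (hA : MeasurableSet A) {x : Fin n → ℝ}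
    {a : ℝ≥0∞} :
    a < maximalInd A x ↔ ∃ c r, 0 < r ∧ x ∈ closedBall c r ∧
      a * volume (closedBall c r) < volume (A ∩ closedBall c r) := by
  unfold maximalInd maximal
  simp only [lt_iSup_iff, lintegral_indicator_one hA, Measure.restrict_apply hA, exists_prop]
  refine exists_congr fun c => exists_congr fun r => and_congr_right fun hr =>
    and_congr_right fun _ => ?_
  rw [mul_comm, ← div_eq_mul_inv, ENNReal.lt_div_iff_mul_lt
    (Or.inl (volume_closedBall_ne_zero c hr)) (Or.inl (volume_closedBall_ne_top c r))]

lemma maximalInd_le_one {A : Set (Fin n → ℝ)} (hA : MeasurableSet A) (x : Fin n → ℝ) :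
    maximalInd A x ≤ 1 := by
  by_contra! h
  obtain ⟨c, r, -, -, h⟩ := (lt_maximalInd_iff hA).1 h
  rw [one_mul] at h
  exact absurd (measure_mono inter_subset_right) h.not_ge

lemma maximalInd_ne_top {A : Set (Fin n → ℝ)} (hA : MeasurableSet A) (x : Fin n → ℝ) :
    maximalInd A x ≠ ∞ :=
  ((maximalInd_le_one hA x).trans_lt ENNReal.one_lt_top).ne

lemma isOpen_lt_maximalInd {A : Set (Fin n → ℝ)} (hA : MeasurableSet A) (a : ℝ≥0∞) :
    IsOpen {x | a < maximalInd A x} := by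
  rw [isOpen_iff_mem_nhds]
  intro x hx
  have ha : a ≠ ∞ := (lt_of_lt_of_le (show a < maximalInd A x from hx) le_top).ne
  obtain ⟨c, r, hr, hxc, h⟩ := (lt_maximalInd_iff hA).1 hx
  have hcont : Tendsto (fun s : ℝ => a * ENNReal.ofReal ((2 * s) ^ n)) (𝓝[>] r)
      (𝓝 (a * ENNReal.ofReal ((2 * r) ^ n))) := by
    refine ENNReal.Tendsto.const_mul ?_ (Or.inr ha)
    refine ((ENNReal.continuous_ofReal.comp (by fun_prop :
      Continuous fun s : ℝ => (2 * s) ^ n)).tendsto r).mono_left nhdsWithin_le_nhds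
  rw [Real.volume_pi_closedBall _ hr.le, Fintype.card_fin] at h
  obtain ⟨s, hs, hrs⟩ := ((hcont.eventually_lt_const h).and self_mem_nhdsWithin).exists
  have hrs : r < s := hrs
  have hs0 : 0 < s := hr.trans hrs
  have hball : ball c s ∈ 𝓝 x :=
    isOpen_ball.mem_nhds (mem_ball.2 ((mem_closedBall.1 hxc).trans_lt hrs))
  filter_upwards [hball] with y hy
  refine (lt_maximalInd_iff hA).2 ⟨c, s, hs0, ball_subset_closedBall hy, ?_⟩
  rw [Real.volume_pi_closedBall _ hs0.le, Fintype.card_fin]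
  exact hs.trans_le (measure_mono
    (inter_subset_inter_right _ (closedBall_subset_closedBall hrs.le)))

lemma measurable_maximalInd {A : Set (Fin n → ℝ)} (hA : MeasurableSet A) :
    Measurable (maximalInd A) :=
  measurable_of_Ioi fun a => (isOpen_lt_maximalInd hA a).measurableSet

lemma ae_lt_maximalInd {A : Set (Fin n → ℝ)} (hA : MeasurableSet A) {a : ℝ≥0∞} (ha : a < 1) :
    ∀ᵐ x ∂volume.restrict A, a < maximalInd A x := by
  filter_upwards [Besicovitch.ae_tendsto_measure_inter_div volume A] with x hx
  obtain ⟨r, h, hr⟩ := ((hx.eventually_const_lt ha).and self_mem_nhdsWithin).exists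
  have hr : 0 < r := hr
  refine (lt_maximalInd_iff hA).2 ⟨x, r, hr, mem_closedBall_self hr.le, ?_⟩
  rwa [ENNReal.lt_div_iff_mul_lt
    (Or.inl (volume_closedBall_ne_zero x hr)) (Or.inl (volume_closedBall_ne_top x r))] at h

lemma exists_radius_bound (hn : 0 < n) {A : Set (Fin n → ℝ)} (hA : volume A ≠ ∞) {a : ℝ≥0∞}
    (ha : a ≠ 0) : ∃ R : ℝ, ∀ (c : Fin n → ℝ) (r : ℝ), 0 < r →
      a * volume (closedBall c r) < volume (A ∩ closedBall c r) → r ≤ R := by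
  refine ⟨1 + (volume A / a).toReal, fun c r hr h => ?_⟩
  have ha' : a ≠ ∞ := by
    rintro rfl
    rw [ENNReal.top_mul (volume_closedBall_ne_zero c hr)] at h
    exact not_top_lt h
  have h1 : volume (closedBall c r) ≤ volume A / a := by
    rw [ENNReal.le_div_iff_mul_le (Or.inl ha) (Or.inl ha'), mul_comm]
    exact h.le.trans (measure_mono inter_subset_left)
  rw [Real.volume_pi_closedBall _ hr.le, Fintype.card_fin,
    ENNReal.ofReal_le_iff_le_toReal (ENNReal.div_ne_top hA ha)] at h1
  have h0 : 0 ≤ (volume A / a).toReal := ENNReal.toReal_nonneg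
  by_cases h2 : r ≤ 1
  · linarith
  · have : 2 * r ≤ (2 * r) ^ n := le_self_pow₀ (by linarith) hn.ne'
    linarith

lemma exists_countable_disjoint_enlargement (t : Set (Fin n → ℝ)) (c : (Fin n → ℝ) → Fin n → ℝ)
    (r : (Fin n → ℝ) → ℝ) (R : ℝ) (hr : ∀ x ∈ t, 0 < r x) (hR : ∀ x ∈ t, r x ≤ R) :
    ∃ u ⊆ t, u.Countable ∧ (u.PairwiseDisjoint fun x => closedBall (c x) (r x)) ∧
      ∀ x ∈ t, ∃ b ∈ u, closedBall (c x) (r x) ⊆ closedBall (c b) (5 * r b) := by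
  obtain ⟨u, hut, hd, hu⟩ := Vitali.exists_disjoint_subfamily_covering_enlargement_closedBall
    t c r R hR 5 (by norm_num)
  refine ⟨u, hut, hd.countable_of_nonempty_interior fun x hx => ?_, hd, hu⟩
  exact (nonempty_ball.2 (hr x (hut hx))).mono ball_subset_interior_closedBall

/-- The weak type `(1, 1)` inequality for indicators. -/
lemma mul_volume_lt_maximalInd_le (hn : 0 < n) {A : Set (Fin n → ℝ)} (hA : MeasurableSet A)
    (hA' : volume A ≠ ∞) {a : ℝ≥0∞} (ha : a ≠ 0) :
    a * volume {x | a < maximalInd A x} ≤ ENNReal.ofReal (5 ^ n) * volume A := by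
  obtain ⟨R, hR⟩ := exists_radius_bound hn hA' ha
  have hex : ∀ x, ∃ c r, a < maximalInd A x → 0 < r ∧ x ∈ closedBall c r ∧
      a * volume (closedBall c r) < volume (A ∩ closedBall c r) := by
    intro x
    by_cases h : a < maximalInd A x
    · obtain ⟨c, r, h⟩ := (lt_maximalInd_iff hA).1 h
      exact ⟨c, r, fun _ => h⟩
    · exact ⟨0, 0, fun h' => absurd h' h⟩
  choose c r hcr using hex
  obtain ⟨u, hut, huc, hd, hu⟩ := exists_countable_disjoint_enlargement
    {x | a < maximalInd A x} c r R (fun x hx => (hcr x hx).1)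
    (fun x hx => hR _ _ (hcr x hx).1 (hcr x hx).2.2)
  have hcover : {x | a < maximalInd A x} ⊆ ⋃ b ∈ u, closedBall (c b) (5 * r b) := by
    intro x hx
    obtain ⟨b, hb, hxb⟩ := hu x hx
    exact mem_biUnion hb (hxb (hcr x hx).2.1)
  calc a * volume {x | a < maximalInd A x}
      ≤ a * ∑' b : u, volume (closedBall (c b) (5 * r b)) := by
        gcongr
        exact (measure_mono hcover).trans (measure_biUnion_le _ huc _)
    _ = ∑' b : u, ENNReal.ofReal (5 ^ n) * (a * volume (closedBall (c b) (r b))) := by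
        rw [← ENNReal.tsum_mul_left]
        refine tsum_congr fun b => ?_
        rw [volume_closedBall_mul (c b) (c b) (by norm_num) (hcr b (hut b.2)).1.le]
        ring
    _ ≤ ∑' b : u, ENNReal.ofReal (5 ^ n) * volume (A ∩ closedBall (c b) (r b)) := by
        gcongr with b
        exact (hcr b (hut b.2)).2.2.le
    _ = ENNReal.ofReal (5 ^ n) * volume (⋃ b ∈ u, A ∩ closedBall (c b) (r b)) := by
        rw [ENNReal.tsum_mul_left, measure_biUnion huc
          (hd.mono fun b => inter_subset_right)
          (fun b _ => hA.inter measurableSet_closedBall)]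
    _ ≤ ENNReal.ofReal (5 ^ n) * volume A := by
        gcongr
        exact iUnion₂_subset fun b _ => inter_subset_left

/-- The reverse weak type inequality for indicators. -/
lemma volume_le_mul_volume_lt_maximalInd (hn : 0 < n) {A : Set (Fin n → ℝ)}
    (hA : MeasurableSet A) (hA' : volume A ≠ ∞) {a : ℝ≥0∞} (ha : a ≠ 0) (ha1 : a < 1) :
    volume A ≤ ENNReal.ofReal (5 ^ n) * (a * volume {x | a < maximalInd A x}) := by
  obtain ⟨R, hR⟩ := exists_radius_bound hn hA' ha
  have hex : ∀ x, ∃ c r, a < maximalInd A x → 0 < r ∧ x ∈ closedBall c r ∧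
      a * volume (closedBall c r) < volume (A ∩ closedBall c r) ∧
      volume (A ∩ closedBall c (5 * r)) ≤ a * volume (closedBall c (5 * r)) := by
    intro x
    by_cases h : a < maximalInd A x
    · let T : Set ℝ := {r | ∃ c, 0 < r ∧ x ∈ closedBall c r ∧
        a * volume (closedBall c r) < volume (A ∩ closedBall c r)}
      have hT : T.Nonempty := by
        obtain ⟨c, r, h⟩ := (lt_maximalInd_iff hA).1 h
        exact ⟨r, c, h⟩
      have hTb : BddAbove T := ⟨R, fun r ⟨c, hr, _, h⟩ => hR c r hr h⟩
      have hpos : 0 < sSup T := by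
        obtain ⟨r, hr⟩ := hT
        exact hr.choose_spec.1.trans_le (le_csSup hTb hr)
      obtain ⟨r, ⟨c, hr, hxc, hlt⟩, hrs⟩ := exists_lt_of_lt_csSup hT (half_lt_self hpos)
      refine ⟨c, r, fun _ => ⟨hr, hxc, hlt, ?_⟩⟩
      by_contra! hcon
      have : 5 * r ∈ T :=
        ⟨c, by positivity, closedBall_subset_closedBall (by linarith) hxc, hcon⟩
      linarith [le_csSup hTb this]
    · exact ⟨0, 0, fun h' => absurd h' h⟩
  choose c r hcr using hex
  obtain ⟨u, hut, huc, hd, hu⟩ := exists_countable_disjoint_enlargement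
    {x | a < maximalInd A x} c r R (fun x hx => (hcr x hx).1)
    (fun x hx => hR _ _ (hcr x hx).1 (hcr x hx).2.2.1)
  have hcover : {x | a < maximalInd A x} ⊆ ⋃ b ∈ u, closedBall (c b) (5 * r b) := by
    intro x hx
    obtain ⟨b, hb, hxb⟩ := hu x hx
    exact mem_biUnion hb (hxb (hcr x hx).2.1)
  have hae : A ≤ᵐ[volume] ⋃ b ∈ u, A ∩ closedBall (c b) (5 * r b) := by
    filter_upwards [(ae_restrict_iff' hA).1 (ae_lt_maximalInd hA ha1)] with x hx hxA
    obtain ⟨b, hb, hxb⟩ := mem_iUnion₂.1 (hcover (hx hxA))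
    exact mem_biUnion hb ⟨hxA, hxb⟩
  calc volume A ≤ ∑' b : u, volume (A ∩ closedBall (c b) (5 * r b)) :=
        (measure_mono_ae hae).trans (measure_biUnion_le _ huc _)
    _ ≤ ∑' b : u, ENNReal.ofReal (5 ^ n) * (a * volume (closedBall (c b) (r b))) := by
        refine ENNReal.tsum_le_tsum fun b => ?_
        refine (hcr b (hut b.2)).2.2.2.trans_eq ?_
        rw [volume_closedBall_mul (c b) (c b) (by norm_num) (hcr b (hut b.2)).1.le]
        ring
    _ = ENNReal.ofReal (5 ^ n) * (a * volume (⋃ b ∈ u, closedBall (c b) (r b))) := by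
        rw [ENNReal.tsum_mul_left, ENNReal.tsum_mul_left, measure_biUnion huc hd
          (fun b _ => measurableSet_closedBall)]
    _ ≤ ENNReal.ofReal (5 ^ n) * (a * volume {x | a < maximalInd A x}) := by
        gcongr
        exact iUnion₂_subset fun b hb y hy =>
          (lt_maximalInd_iff hA).2 ⟨c b, r b, (hcr b (hut hb)).1, hy, (hcr b (hut hb)).2.2.1⟩

lemma ofReal_posLog_le_tsum {u : ℝ} (hu : 0 ≤ u) :
    ENNReal.ofReal (Real.posLog u) ≤ ∑' k : ℕ, {v : ℝ | 2 ^ k < v}.indicator 1 u := by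
  classical
  have hex : ∃ N : ℕ, u ≤ 2 ^ N := by
    obtain ⟨N, hN⟩ := pow_unbounded_of_one_lt u (one_lt_two)
    exact ⟨N, hN.le⟩
  have hlog : Real.posLog u ≤ (Nat.find hex : ℝ) := by
    refine (Real.posLog_le_posLog hu (Nat.find_spec hex)).trans ?_
    rw [Real.posLog_pow]
    refine mul_le_of_le_one_right (Nat.cast_nonneg _) ?_
    rw [Real.posLog_eq_log (by norm_num)]
    linarith [Real.log_two_lt_d9]
  calc ENNReal.ofReal (Real.posLog u) ≤ ENNReal.ofReal (Nat.find hex : ℝ) :=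
        ENNReal.ofReal_le_ofReal hlog
    _ = ∑ k ∈ Finset.range (Nat.find hex), ({v : ℝ | 2 ^ k < v}.indicator 1 u : ℝ≥0∞) := by
        rw [Finset.sum_congr rfl (g := fun _ => (1 : ℝ≥0∞))]
        · simp
        · intro k hk
          exact indicator_of_mem (not_le.1 (Nat.find_min hex (Finset.mem_range.1 hk))) _
    _ ≤ _ := ENNReal.sum_le_tsum _

lemma lintegral_posLog_le {Q : Set (Fin n → ℝ)} {g : (Fin n → ℝ) → ℝ≥0∞} (hg : Measurable g)
    (hg' : ∀ x, g x ≠ ∞) {a : ℝ} (ha : 0 < a) {K : ℝ≥0∞}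
    (hK : ∀ k : ℕ, volume (Q ∩ {x | ENNReal.ofReal a * 2 ^ k < g x}) ≤ K * 2⁻¹ ^ k) :
    ∫⁻ x in Q, ENNReal.ofReal (Real.posLog ((g x).toReal / a)) ≤ 2 * K := by
  have hset : ∀ k : ℕ, MeasurableSet {x | ENNReal.ofReal a * 2 ^ k < g x} := fun k =>
    measurableSet_lt measurable_const hg
  calc ∫⁻ x in Q, ENNReal.ofReal (Real.posLog ((g x).toReal / a))
      ≤ ∫⁻ x in Q, ∑' k : ℕ, {x | ENNReal.ofReal a * 2 ^ k < g x}.indicator 1 x := by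
        refine lintegral_mono fun x => ?_
        refine (ofReal_posLog_le_tsum (by positivity)).trans (ENNReal.tsum_le_tsum fun k => ?_)
        rw [indicator_apply, indicator_apply]
        split_ifs with h1 h2
        · exact le_rfl
        · refine absurd ?_ h2
          have h3 : 2 ^ k * a < (g x).toReal := (lt_div_iff₀ ha).1 h1
          have h4 := (ENNReal.ofReal_lt_iff_lt_toReal (by positivity) (hg' x)).2 h3
          rwa [ENNReal.ofReal_mul (by positivity), ENNReal.ofReal_pow zero_le_two,
            ENNReal.ofReal_ofNat, mul_comm] at h4
        · exact zero_le
        · exact zero_le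
    _ = ∑' k : ℕ, volume (Q ∩ {x | ENNReal.ofReal a * 2 ^ k < g x}) := by
        rw [lintegral_tsum fun k => (measurable_one.indicator (hset k)).aemeasurable]
        refine tsum_congr fun k => ?_
        rw [lintegral_indicator_one (hset k), Measure.restrict_apply (hset k), inter_comm]
    _ ≤ ∑' k : ℕ, K * 2⁻¹ ^ k := ENNReal.tsum_le_tsum hK
    _ = 2 * K := by
        rw [ENNReal.tsum_mul_left, ENNReal.tsum_geometric, ENNReal.one_sub_inv_two, inv_inv,
          mul_comm]

lemma lintegral_sub_average_le {Q : Set (Fin n → ℝ)} (hQ : volume Q ≠ 0) (hQ' : volume Q ≠ ∞)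
    {f : (Fin n → ℝ) → ℝ} (hf : IntegrableOn f Q) (c : ℝ) :
    ∫⁻ y in Q, ‖f y - ⨍ z in Q, f z‖ₑ ≤ 2 * ∫⁻ y in Q, ‖f y - c‖ₑ := by
  have hreal : volume.real Q ≠ 0 := (ENNReal.toReal_pos hQ hQ').ne'
  have hc : IntegrableOn (fun _ => c) Q := integrableOn_const hQ'
  have hint : volume.real Q * ((⨍ z in Q, f z) - c) = ∫ z in Q, (f z - c) := by
    rw [integral_sub hf hc, setAverage_eq, setIntegral_const, smul_eq_mul, smul_eq_mul]
    field_simp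
  have key : ‖(⨍ z in Q, f z) - c‖ₑ * volume Q ≤ ∫⁻ y in Q, ‖f y - c‖ₑ := by
    refine le_trans (le_of_eq ?_) (enorm_integral_le_lintegral_enorm _)
    rw [← hint, enorm_mul, mul_comm, Real.enorm_of_nonneg measureReal_nonneg,
      ofReal_measureReal hQ']
  calc ∫⁻ y in Q, ‖f y - ⨍ z in Q, f z‖ₑ
      ≤ ∫⁻ y in Q, (‖f y - c‖ₑ + ‖(⨍ z in Q, f z) - c‖ₑ) := by
        refine lintegral_mono fun y => ?_
        rw [← sub_sub_sub_cancel_right (f y) _ c]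
        exact enorm_sub_le
    _ = (∫⁻ y in Q, ‖f y - c‖ₑ) + ‖(⨍ z in Q, f z) - c‖ₑ * volume Q := by
        rw [lintegral_add_right _ measurable_const, setLIntegral_const]
    _ ≤ 2 * ∫⁻ y in Q, ‖f y - c‖ₑ := by
        rw [two_mul]
        gcongr

lemma measurable_posLog_maximalInd {E : Set (Fin n → ℝ)} (hE : MeasurableSet E) (l : ℝ) :
    Measurable fun x => Real.posLog ((maximalInd E x).toReal / l) :=
  Real.continuous_posLog.measurable.comp ((measurable_maximalInd hE).ennreal_toReal.div_const l)

lemma integrableOn_posLog_maximalInd {E : Set (Fin n → ℝ)} (hE : MeasurableSet E) {l : ℝ}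
    (hl : 0 < l) {Q : Set (Fin n → ℝ)} (hQ : volume Q ≠ ∞) :
    IntegrableOn (fun x => Real.posLog ((maximalInd E x).toReal / l)) Q := by
  refine Measure.integrableOn_of_bounded (M := Real.posLog (1 / l)) hQ
    (measurable_posLog_maximalInd hE l).aestronglyMeasurable (Eventually.of_forall fun x => ?_)
  rw [Real.norm_of_nonneg Real.posLog_nonneg]
  refine Real.posLog_le_posLog (by positivity) ?_
  gcongr
  exact ENNReal.toReal_le_of_le_ofReal zero_le_one (by simpa using maximalInd_le_one hE x)

lemma le_mul_inv_two_pow {a V W : ℝ≥0∞} (ha : a ≠ 0) (ha' : a ≠ ∞) {k : ℕ}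
    (h : a * 2 ^ k * V ≤ a * W) : V ≤ W * 2⁻¹ ^ k := by
  rw [mul_assoc, ENNReal.mul_le_mul_iff_right ha ha'] at h
  rw [← ENNReal.inv_pow, ← div_eq_mul_inv, ENNReal.le_div_iff_mul_le (by simp) (by simp), mul_comm]
  exact h

/-- A cube through a point of a cube `Q` which is not larger than `Q` lies in `3Q`. -/
lemma closedBall_subset_of_radius_le {c c' y : Fin n → ℝ} {r r' : ℝ} (hy : y ∈ closedBall c r)
    (hy' : y ∈ closedBall c' r') (h : r' ≤ r) : closedBall c' r' ⊆ closedBall c (3 * r) := by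
  intro z hz
  rw [mem_closedBall] at *
  have h1 := dist_triangle z c' c
  have h2 := dist_triangle_left c' c y
  linarith

lemma le_mul_maximalInd_of_closedBall {E : Set (Fin n → ℝ)} (hE : MeasurableSet E)
    {c z : Fin n → ℝ} {r k : ℝ} {a : ℝ≥0∞} (hr : 0 < r) (hk : 1 ≤ k)
    (h : a * volume (closedBall c r) < volume (E ∩ closedBall c r))
    (hz : z ∈ closedBall c (k * r)) : a ≤ ENNReal.ofReal (k ^ n) * maximalInd E z := by
  have h1 : volume (E ∩ closedBall c r) ≤ volume (E ∩ closedBall c (k * r)) :=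
    measure_mono (inter_subset_inter_right _
      (closedBall_subset_closedBall (le_mul_of_one_le_left hr.le hk)))
  have h2 := h.le.trans (h1.trans (le_volume_mul_maximalInd hE (by positivity) hz))
  rw [volume_closedBall_mul c c (by positivity) hr.le, ← mul_assoc] at h2
  rw [mul_comm (ENNReal.ofReal _)]
  exact (ENNReal.mul_le_mul_iff_left (volume_closedBall_ne_zero c hr)
    (volume_closedBall_ne_top c r)).1 h2

/-- The Coifman–Rochberg theorem: `log⁺ (Mχ_E / l)` has bounded mean oscillation. -/
lemma lintegral_posLog_maximalInd_sub_average_le (hn : 0 < n) {E : Set (Fin n → ℝ)}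
    (hE : MeasurableSet E) {l : ℝ} (hl : 0 < l) (c : Fin n → ℝ) {r : ℝ} (hr : 0 < r) :
    ∫⁻ y in closedBall c r, ‖Real.posLog ((maximalInd E y).toReal / l) -
        ⨍ z in closedBall c r, Real.posLog ((maximalInd E z).toReal / l)‖ₑ ≤
      4 * ENNReal.ofReal (15 ^ n) * volume (closedBall c r) := by
  set Q := closedBall c r with hQ
  set m : ℝ≥0∞ := ⨅ z ∈ Q, maximalInd E z with hm
  have hmle : ∀ z ∈ Q, m ≤ maximalInd E z := fun z hz => iInf₂_le z hz
  have hlem : ∀ b, (∀ z ∈ Q, b ≤ maximalInd E z) → b ≤ m := fun b hb => le_iInf₂ hb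
  have hcQ : c ∈ Q := mem_closedBall_self hr.le
  have hm_top : m ≠ ∞ := ne_top_of_le_ne_top (maximalInd_ne_top hE c) (hmle c hcQ)
  set m' : ℝ := max m.toReal l with hm'
  have hm'0 : 0 < m' := hl.trans_le (le_max_right _ _)
  have hmm' : m ≤ ENNReal.ofReal m' := by
    rw [← ENNReal.ofReal_toReal hm_top]
    exact ENNReal.ofReal_le_ofReal (le_max_left _ _)
  have h0 : ENNReal.ofReal m' ≠ 0 := by simpa using hm'0
  have h35 : ENNReal.ofReal (5 ^ n) * ENNReal.ofReal (3 ^ n) = ENNReal.ofReal (15 ^ n) := by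
    rw [← ENNReal.ofReal_mul (by positivity), ← mul_pow]
    norm_num
  have hQ3 : volume (E ∩ closedBall c (3 * r)) ≤ m * (ENNReal.ofReal (3 ^ n) * volume Q) := by
    rw [hQ, ← volume_closedBall_mul c c (by norm_num) hr.le]
    have h3r : 0 < 3 * r := by positivity
    rw [← ENNReal.div_le_iff (volume_closedBall_ne_zero c h3r) (volume_closedBall_ne_top c _)]
    refine hlem _ fun z hz => ?_
    rw [ENNReal.div_le_iff (volume_closedBall_ne_zero c h3r) (volume_closedBall_ne_top c _)]
    exact le_volume_mul_maximalInd hE h3r (closedBall_subset_closedBall (by linarith) hz)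
  have hweak : ∀ k : ℕ, volume (Q ∩ {x | ENNReal.ofReal m' * 2 ^ k < maximalInd E x}) ≤
      ENNReal.ofReal (15 ^ n) * volume Q * 2⁻¹ ^ k := by
    intro k
    refine le_mul_inv_two_pow h0 ENNReal.ofReal_ne_top ?_
    by_cases hk : ENNReal.ofReal m' * 2 ^ k ≤ ENNReal.ofReal (3 ^ n) * m
    · calc ENNReal.ofReal m' * 2 ^ k *
            volume (Q ∩ {x | ENNReal.ofReal m' * 2 ^ k < maximalInd E x})
          ≤ ENNReal.ofReal (15 ^ n) * ENNReal.ofReal m' * volume Q := by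
            refine mul_le_mul' (hk.trans ?_) (measure_mono inter_subset_left)
            gcongr
            norm_num
        _ = _ := by ring
    · have hsub : Q ∩ {x | ENNReal.ofReal m' * 2 ^ k < maximalInd E x} ⊆
          {x | ENNReal.ofReal m' * 2 ^ k < maximalInd (E ∩ closedBall c (3 * r)) x} := by
        rintro y ⟨hyQ, hy⟩
        obtain ⟨c', r', hr', hyc', h⟩ := (lt_maximalInd_iff hE).1 hy
        rcases le_or_gt r' r with hrr | hrr
        · refine (lt_maximalInd_iff (hE.inter measurableSet_closedBall)).2
            ⟨c', r', hr', hyc', ?_⟩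
          rwa [inter_assoc, inter_eq_self_of_subset_right
            (closedBall_subset_of_radius_le hyQ hyc' hrr)]
        · refine absurd ?_ hk
          rw [mul_comm (ENNReal.ofReal (3 ^ n)), ← ENNReal.div_le_iff_le_mul (by simp) (by simp)]
          refine hlem _ fun z hz => ?_
          rw [ENNReal.div_le_iff_le_mul (by simp) (by simp), mul_comm (maximalInd E z)]
          refine le_mul_maximalInd_of_closedBall hE hr' (by norm_num) h ?_
          rw [mem_closedBall] at *
          have h1 := dist_triangle_right z y c
          have h2 := dist_triangle z y c'
          linarith
      calc ENNReal.ofReal m' * 2 ^ k *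
            volume (Q ∩ {x | ENNReal.ofReal m' * 2 ^ k < maximalInd E x})
          ≤ ENNReal.ofReal m' * 2 ^ k * volume
              {x | ENNReal.ofReal m' * 2 ^ k < maximalInd (E ∩ closedBall c (3 * r)) x} := by
            gcongr
        _ ≤ ENNReal.ofReal (5 ^ n) * volume (E ∩ closedBall c (3 * r)) :=
            mul_volume_lt_maximalInd_le hn (hE.inter measurableSet_closedBall)
              (ne_top_of_le_ne_top (volume_closedBall_ne_top c (3 * r))
                (measure_mono inter_subset_right)) (mul_ne_zero h0 (by simp))
        _ ≤ ENNReal.ofReal (5 ^ n) *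
              (ENNReal.ofReal m' * (ENNReal.ofReal (3 ^ n) * volume Q)) := by
            gcongr
            exact hQ3.trans (by gcongr)
        _ = ENNReal.ofReal m' * (ENNReal.ofReal (15 ^ n) * volume Q) := by
            rw [← h35]
            ring
  have hosc : ∀ y ∈ Q, ‖Real.posLog ((maximalInd E y).toReal / l) - Real.posLog (m.toReal / l)‖ₑ ≤
      ENNReal.ofReal (Real.posLog ((maximalInd E y).toReal / m')) := by
    intro y hy
    have h1 : m.toReal ≤ (maximalInd E y).toReal :=
      ENNReal.toReal_mono (maximalInd_ne_top hE y) (hmle y hy)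
    have h2 : Real.posLog (m.toReal / l) ≤ Real.posLog ((maximalInd E y).toReal / l) :=
      Real.posLog_le_posLog (by positivity) (by gcongr)
    have h3 : Real.posLog (m' / l) = Real.posLog (m.toReal / l) := by
      rcases le_total m.toReal l with h | h
      · rw [hm', max_eq_right h, div_self hl.ne', Real.posLog_one, eq_comm,
          Real.posLog_eq_zero_iff, abs_of_nonneg (by positivity)]
        exact (div_le_one hl).2 h
      · rw [hm', max_eq_left h]
    have h4 : Real.posLog ((maximalInd E y).toReal / l) ≤
        Real.posLog ((maximalInd E y).toReal / m') + Real.posLog (m' / l) := by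
      refine le_trans (le_of_eq ?_) Real.posLog_mul
      congr 1
      field_simp
    rw [Real.enorm_of_nonneg (sub_nonneg.2 h2)]
    exact ENNReal.ofReal_le_ofReal (by linarith)
  calc _ ≤ 2 * ∫⁻ y in Q, ‖Real.posLog ((maximalInd E y).toReal / l) -
          Real.posLog (m.toReal / l)‖ₑ :=
        lintegral_sub_average_le (volume_closedBall_ne_zero c hr) (volume_closedBall_ne_top c r)
          (integrableOn_posLog_maximalInd hE hl (volume_closedBall_ne_top c r)) _
    _ ≤ 2 * ∫⁻ y in Q, ENNReal.ofReal (Real.posLog ((maximalInd E y).toReal / m')) := by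
        gcongr 2 * ?_
        exact setLIntegral_mono' measurableSet_closedBall hosc
    _ ≤ 2 * (2 * (ENNReal.ofReal (15 ^ n) * volume Q)) := by
        gcongr 2 * ?_
        exact lintegral_posLog_le (measurable_maximalInd hE) (maximalInd_ne_top hE) hm'0 hweak
    _ = 4 * ENNReal.ofReal (15 ^ n) * volume Q := by
        ring

lemma lintegral_posLog_maximalInd_sub_average_le_volume (hn : 0 < n) {E : Set (Fin n → ℝ)}
    (hE : MeasurableSet E) {l : ℝ} (hl : 0 < l) (hl1 : l < 1) (c : Fin n → ℝ) {r : ℝ} (hr : 0 < r)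
    (hsmall : ∀ c' r', 0 < r' → ENNReal.ofReal l * volume (closedBall c' r') <
      volume (E ∩ closedBall c' r') → (closedBall c' r' ∩ closedBall c (3 * r)).Nonempty →
      r' ≤ r) :
    ∫⁻ y in closedBall c r, ‖Real.posLog ((maximalInd E y).toReal / l) -
        ⨍ z in closedBall c r, Real.posLog ((maximalInd E z).toReal / l)‖ₑ ≤
      4 * ENNReal.ofReal (25 ^ n) *
        volume ({y | ENNReal.ofReal l < maximalInd E y} ∩ closedBall c (5 * r)) := by
  set E' := E ∩ closedBall c (3 * r) with hE'
  have hE'm : MeasurableSet E' := hE.inter measurableSet_closedBall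
  have hE't : volume E' ≠ ∞ := ne_top_of_le_ne_top (volume_closedBall_ne_top c (3 * r))
    (measure_mono inter_subset_right)
  have h0 : ENNReal.ofReal l ≠ 0 := by simpa using hl
  have h55 : ENNReal.ofReal (5 ^ n) * ENNReal.ofReal (5 ^ n) = ENNReal.ofReal (25 ^ n) := by
    rw [← ENNReal.ofReal_mul (by positivity), ← mul_pow]
    norm_num
  have hO : {x | ENNReal.ofReal l < maximalInd E' x} ⊆
      {y | ENNReal.ofReal l < maximalInd E y} ∩ closedBall c (5 * r) := by
    intro z hz
    obtain ⟨c', r', hr', hzc', h⟩ := (lt_maximalInd_iff hE'm).1 hz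
    have hEE' : volume (E' ∩ closedBall c' r') ≤ volume (E ∩ closedBall c' r') :=
      measure_mono (inter_subset_inter_left _ inter_subset_left)
    obtain ⟨v, ⟨-, hv3⟩, hv'⟩ : (E' ∩ closedBall c' r').Nonempty :=
      nonempty_of_measure_ne_zero (pos_of_gt h).ne'
    have hrr := hsmall c' r' hr' (h.trans_le hEE') ⟨v, hv', hv3⟩
    refine ⟨(lt_maximalInd_iff hE).2 ⟨c', r', hr', hzc', h.trans_le hEE'⟩, ?_⟩
    rw [mem_closedBall] at *
    have h1 := dist_triangle_right z v c'
    have h2 := dist_triangle z v c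
    linarith
  have hweak : ∀ k : ℕ, volume (closedBall c r ∩ {x | ENNReal.ofReal l * 2 ^ k < maximalInd E x})
      ≤ ENNReal.ofReal (25 ^ n) * volume {x | ENNReal.ofReal l < maximalInd E' x} * 2⁻¹ ^ k := by
    intro k
    refine le_mul_inv_two_pow h0 ENNReal.ofReal_ne_top ?_
    have hsub : closedBall c r ∩ {x | ENNReal.ofReal l * 2 ^ k < maximalInd E x} ⊆
        {x | ENNReal.ofReal l * 2 ^ k < maximalInd E' x} := by
      rintro y ⟨hyQ, hy⟩
      obtain ⟨c', r', hr', hyc', h⟩ := (lt_maximalInd_iff hE).1 hy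
      have hl2 : ENNReal.ofReal l ≤ ENNReal.ofReal l * 2 ^ k :=
        le_mul_of_one_le_right zero_le (one_le_pow₀ one_le_two)
      have hrr : r' ≤ r := hsmall c' r' hr' (lt_of_le_of_lt (by gcongr) h)
        ⟨y, hyc', closedBall_subset_closedBall (by linarith) hyQ⟩
      refine (lt_maximalInd_iff hE'm).2 ⟨c', r', hr', hyc', ?_⟩
      rwa [hE', inter_assoc, inter_eq_self_of_subset_right
        (closedBall_subset_of_radius_le hyQ hyc' hrr)]
    calc ENNReal.ofReal l * 2 ^ k *
          volume (closedBall c r ∩ {x | ENNReal.ofReal l * 2 ^ k < maximalInd E x})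
        ≤ ENNReal.ofReal l * 2 ^ k * volume {x | ENNReal.ofReal l * 2 ^ k < maximalInd E' x} := by
          gcongr
      _ ≤ ENNReal.ofReal (5 ^ n) * volume E' :=
          mul_volume_lt_maximalInd_le hn hE'm hE't (mul_ne_zero h0 (by simp))
      _ ≤ ENNReal.ofReal (5 ^ n) * (ENNReal.ofReal (5 ^ n) *
            (ENNReal.ofReal l * volume {x | ENNReal.ofReal l < maximalInd E' x})) := by
          gcongr
          exact volume_le_mul_volume_lt_maximalInd hn hE'm hE't h0 (by simpa using hl1)
      _ = _ := by
          rw [← h55]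
          ring
  calc _ ≤ 2 * ∫⁻ y in closedBall c r, ‖Real.posLog ((maximalInd E y).toReal / l) - 0‖ₑ :=
        lintegral_sub_average_le (volume_closedBall_ne_zero c hr) (volume_closedBall_ne_top c r)
          (integrableOn_posLog_maximalInd hE hl (volume_closedBall_ne_top c r)) _
    _ = 2 * ∫⁻ y in closedBall c r, ENNReal.ofReal (Real.posLog ((maximalInd E y).toReal / l)) := by
        simp only [sub_zero, Real.enorm_of_nonneg Real.posLog_nonneg]
    _ ≤ 2 * (2 * (ENNReal.ofReal (25 ^ n) *
          volume {x | ENNReal.ofReal l < maximalInd E' x})) := by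
        gcongr 2 * ?_
        exact lintegral_posLog_le (measurable_maximalInd hE) (maximalInd_ne_top hE) hl hweak
    _ = 4 * ENNReal.ofReal (25 ^ n) * volume {x | ENNReal.ofReal l < maximalInd E' x} := by
        ring
    _ ≤ _ := by
        gcongr

lemma sharpMax_posLog_maximalInd_le (hn : 0 < n) {E : Set (Fin n → ℝ)}
    (hE : MeasurableSet E) {l : ℝ} (hl : 0 < l) (hl1 : l < 1) (x : Fin n → ℝ) :
    sharpMax (fun y => Real.posLog ((maximalInd E y).toReal / l)) x ≤
      ENNReal.ofReal (4 * 125 ^ n) *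
        maximalInd {y | ENNReal.ofReal (l / (2 * 9 ^ n)) ≤ maximalInd E y} x := by
  set S := {y | ENNReal.ofReal (l / (2 * 9 ^ n)) ≤ maximalInd E y} with hS
  have hSm : MeasurableSet S := measurableSet_le measurable_const (measurable_maximalInd hE)
  unfold sharpMax
  refine iSup₂_le fun c r => iSup₂_le fun hr hx => ?_
  have hQ0 := volume_closedBall_ne_zero c hr
  have hQt := volume_closedBall_ne_top c r
  simp only [← enorm_eq_nnnorm]
  rw [mul_comm, ← div_eq_mul_inv, ENNReal.div_le_iff hQ0 hQt]
  by_cases hbig : ∃ c' r', 0 < r' ∧ ENNReal.ofReal l * volume (closedBall c' r') <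
      volume (E ∩ closedBall c' r') ∧ (closedBall c' r' ∩ closedBall c (3 * r)).Nonempty ∧ r < r'
  · obtain ⟨c', r', hr', h, ⟨v, hv', hv⟩, hrr⟩ := hbig
    have hQS : closedBall c r ⊆ S := by
      intro z hz
      have hz5 : z ∈ closedBall c' (5 * r') := by
        rw [mem_closedBall] at *
        have h1 := dist_triangle z c c'
        have h2 := dist_triangle_left c c' v
        linarith
      have h5 := le_mul_maximalInd_of_closedBall hE hr' (by norm_num) h hz5
      rw [mul_comm (ENNReal.ofReal (5 ^ n)), ← ENNReal.div_le_iff_le_mul (by simp) (by simp),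
        ← ENNReal.ofReal_div_of_pos (by positivity)] at h5
      refine le_trans (ENNReal.ofReal_le_ofReal ?_) h5
      gcongr
      calc (5 : ℝ) ^ n ≤ 9 ^ n := by gcongr; norm_num
        _ ≤ 2 * 9 ^ n := le_mul_of_one_le_left (by positivity) one_le_two
    have h1 := le_volume_mul_maximalInd hSm hr hx
    rw [inter_eq_self_of_subset_right hQS] at h1
    calc _ ≤ 4 * ENNReal.ofReal (15 ^ n) * volume (closedBall c r) :=
          lintegral_posLog_maximalInd_sub_average_le hn hE hl c hr
      _ ≤ ENNReal.ofReal (4 * 125 ^ n) * (maximalInd S x * volume (closedBall c r)) := by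
          rw [ENNReal.ofReal_mul (by norm_num), ENNReal.ofReal_ofNat]
          gcongr
          norm_num
      _ = _ := by ring
  · push Not at hbig
    have h5r : 0 < 5 * r := by positivity
    have hsub : {y | ENNReal.ofReal l < maximalInd E y} ⊆ S := by
      intro y hy
      refine le_trans (ENNReal.ofReal_le_ofReal ?_) (le_of_lt hy)
      refine div_le_self hl.le ?_
      have : (1 : ℝ) ≤ 9 ^ n := one_le_pow₀ (by norm_num)
      linarith
    calc _ ≤ 4 * ENNReal.ofReal (25 ^ n) *
          volume ({y | ENNReal.ofReal l < maximalInd E y} ∩ closedBall c (5 * r)) :=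
          lintegral_posLog_maximalInd_sub_average_le_volume hn hE hl hl1 c hr hbig
      _ ≤ 4 * ENNReal.ofReal (25 ^ n) * (maximalInd S x * volume (closedBall c (5 * r))) := by
          gcongr
          exact (measure_mono (inter_subset_inter_left _ hsub)).trans
            (le_volume_mul_maximalInd hSm h5r (closedBall_subset_closedBall (by linarith) hx))
      _ = _ := by
          rw [volume_closedBall_mul c c (by norm_num) hr.le, ENNReal.ofReal_mul (by norm_num),
            ENNReal.ofReal_ofNat, (by norm_num : (125 : ℝ) = 25 * 5), mul_pow,
            ENNReal.ofReal_mul (by positivity)]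
          ring

lemma lintegral_eq_zero_of_weak_feffermanStein_of_dim_zero (hn : n = 0)
    (w : (Fin n → ℝ) → ℝ≥0∞) {p : ℝ} (hp : 0 < p) (C : ℝ≥0∞)
    (hFS : ∀ f : (Fin n → ℝ) → ℝ, Measurable f →
      (∀ α : ℝ, 0 < α → volume {x | α < |f x|} < ∞) →
      ∀ t : ℝ≥0∞, t * (∫⁻ x in {x | t < (‖f x‖₊ : ℝ≥0∞)}, w x) ^ (1/p) ≤
        C * (∫⁻ x, (sharpMax f x) ^ p * w x) ^ (1/p)) :
    ∫⁻ x, w x = 0 := by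
  subst hn
  have hsharp : ∀ x, sharpMax (fun _ : Fin 0 → ℝ => (2 : ℝ)) x = 0 := by
    intro x
    simp only [sharpMax, ENNReal.iSup_eq_zero]
    intro c r hr _
    rw [setAverage_const (volume_closedBall_ne_zero c hr) (volume_closedBall_ne_top c r)]
    simp
  have h := hFS (fun _ => 2) measurable_const
    (fun α _ => (measure_mono (subset_univ _)).trans_lt (by simp [volume_pi])) 1
  have h2 : (1 : ℝ≥0∞) < (‖(2 : ℝ)‖₊ : ℝ≥0∞) := by simp
  simp only [hsharp, h2, ENNReal.zero_rpow_of_pos hp, zero_mul, lintegral_zero,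
    ENNReal.zero_rpow_of_pos (one_div_pos.2 hp), mul_zero, one_mul, ofPred_true,
    Measure.restrict_univ, nonpos_iff_eq_zero, ENNReal.rpow_eq_zero_iff_of_pos (one_div_pos.2 hp)]
    at h
  exact h

end CubeMaximal

/-- Suppose the weak Fefferman–Stein inequality
`‖f‖_{L^{p,∞}(w)} ≤ C ‖f^#‖_{L^p(w)}` holds for all `f ∈ S₀` (i.e. all `f` whose
distribution sets have finite measure). Then for every bounded measurable `E` of
positive measure and every `λ ∈ (0,1)`,
`w(E) ≤ C'/(log(1/λ))^p · ∫ (Mχ_{{Mχ_E ≥ λ/(2·9^n)}})^p w`. -/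
theorem stmt16 {n : ℕ} (w : (Fin n → ℝ) → ℝ≥0∞) (hw : Measurable w)
    (p : ℝ) (hp : 0 < p) (C : ℝ≥0∞) (hC : C < ∞)
    (hFS : ∀ f : (Fin n → ℝ) → ℝ, Measurable f →
      (∀ α : ℝ, 0 < α → volume {x | α < |f x|} < ∞) →
      ∀ t : ℝ≥0∞, t * (∫⁻ x in {x | t < (‖f x‖₊ : ℝ≥0∞)}, w x) ^ (1/p) ≤
        C * (∫⁻ x, (sharpMax f x) ^ p * w x) ^ (1/p)) :
    ∃ C' : ℝ, 0 < C' ∧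
      ∀ E : Set (Fin n → ℝ), MeasurableSet E → IsBounded E → 0 < volume E →
        ∀ l : ℝ, 0 < l → l < 1 →
          ∫⁻ x in E, w x ≤
            ENNReal.ofReal (C' / Real.log (1/l) ^ p) *
              ∫⁻ x, (maximalInd
                {y | ENNReal.ofReal (l / (2 * 9 ^ n)) ≤ maximalInd E y} x) ^ p * w x := by
  rcases Nat.eq_zero_or_pos n with hn | hn
  · refine ⟨1, one_pos, fun E _ _ _ l _ _ => ?_⟩
    refine (setLIntegral_le_lintegral E w).trans ?_
    rw [lintegral_eq_zero_of_weak_feffermanStein_of_dim_zero hn w hp C hFS]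
    exact zero_le
  set K : ℝ := 4 * 125 ^ n with hK
  have hK0 : 0 < K := by positivity
  refine ⟨(2 * C.toReal * K) ^ p + 1, by positivity, fun E hE hEb hE0 l hl hl1 => ?_⟩
  set S := {y | ENNReal.ofReal (l / (2 * 9 ^ n)) ≤ maximalInd E y} with hS
  set L : ℝ := Real.log (1 / l) with hL
  have hL0 : 0 < L := Real.log_pos ((one_lt_div hl).2 hl1)
  set f : (Fin n → ℝ) → ℝ := fun x => Real.posLog ((maximalInd E x).toReal / l) with hf
  have hEt : volume E ≠ ∞ := hEb.measure_lt_top.ne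
  have hl0 : ENNReal.ofReal l ≠ 0 := by simpa using hl
  have hS0 : ∀ α : ℝ, 0 < α → volume {x | α < |f x|} < ∞ := by
    intro α hα
    have hsub : {x | α < |f x|} ⊆ {x | ENNReal.ofReal l < maximalInd E x} := by
      intro x hx
      by_contra hcon
      have h1 : (maximalInd E x).toReal ≤ l := ENNReal.toReal_le_of_le_ofReal hl.le (not_lt.1 hcon)
      have h2 : f x = 0 := by
        rw [hf, Real.posLog_eq_zero_iff, abs_of_nonneg (by positivity)]
        exact (div_le_one hl).2 h1
      have hx : α < |f x| := hx
      rw [h2, abs_zero] at hx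
      exact hx.not_gt hα
    refine (measure_mono hsub).trans_lt ?_
    refine ENNReal.lt_top_of_mul_ne_top_right (ne_top_of_le_ne_top ?_
      (mul_volume_lt_maximalInd_le hn hE hEt hl0)) hl0
    exact ENNReal.mul_ne_top ENNReal.ofReal_ne_top hEt
  have hEw : ∫⁻ x in E, w x ≤ ∫⁻ x in {x | ENNReal.ofReal (L / 2) < (‖f x‖₊ : ℝ≥0∞)}, w x := by
    refine lintegral_mono' (Measure.restrict_mono_ae ?_) le_rfl
    have h1 : ENNReal.ofReal √l < 1 := by
      simpa using (Real.sqrt_lt' one_pos).2 (by simpa using hl1)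
    filter_upwards [(ae_restrict_iff' hE).1 (ae_lt_maximalInd hE h1)] with x hx hxE
    have h2 : √l < (maximalInd E x).toReal :=
      (ENNReal.ofReal_lt_iff_lt_toReal (Real.sqrt_nonneg l) (maximalInd_ne_top hE x)).1 (hx hxE)
    have hsq : 0 < √l := Real.sqrt_pos.2 hl
    have h3 : L / 2 < f x := by
      calc L / 2 = Real.log √l - Real.log l := by
            rw [hL, one_div, Real.log_inv, Real.log_sqrt hl.le]
            ring
        _ < Real.log (maximalInd E x).toReal - Real.log l := by
            gcongr
        _ = Real.log ((maximalInd E x).toReal / l) :=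
            (Real.log_div (hsq.trans h2).ne' hl.ne').symm
        _ ≤ f x := le_max_right _ _
    change ENNReal.ofReal (L / 2) < ‖f x‖ₑ
    rw [Real.enorm_of_nonneg Real.posLog_nonneg]
    exact (ENNReal.ofReal_lt_ofReal_iff (lt_trans (by positivity) h3)).2 h3
  set I := ∫⁻ x, (maximalInd S x) ^ p * w x with hI
  have hsharp : ∫⁻ x, (sharpMax f x) ^ p * w x ≤ ENNReal.ofReal K ^ p * I := by
    rw [hI, ← lintegral_const_mul' _ _ (by simp [hp.le])]
    refine lintegral_mono fun x => ?_
    rw [← mul_assoc, ← ENNReal.mul_rpow_of_nonneg _ _ hp.le]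
    gcongr
    exact sharpMax_posLog_maximalInd_le hn hE hl hl1 x
  have hmain := hFS f (measurable_posLog_maximalInd hE l) hS0 (ENNReal.ofReal (L / 2))
  have hmain' : ENNReal.ofReal (L / 2) * (∫⁻ x in E, w x) ^ (1 / p) ≤
      C * (ENNReal.ofReal K ^ p * I) ^ (1 / p) :=
    le_trans (by gcongr) (hmain.trans (by gcongr))
  have hpow := ENNReal.rpow_le_rpow hmain' hp.le
  rw [ENNReal.mul_rpow_of_nonneg _ _ hp.le, ENNReal.mul_rpow_of_nonneg _ _ hp.le,
    ← ENNReal.rpow_mul, ← ENNReal.rpow_mul, one_div_mul_cancel hp.ne', ENNReal.rpow_one,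
    ENNReal.rpow_one, ← ENNReal.ofReal_toReal hC.ne, ENNReal.ofReal_rpow_of_pos (by positivity),
    ENNReal.ofReal_rpow_of_nonneg ENNReal.toReal_nonneg hp.le,
    ENNReal.ofReal_rpow_of_pos hK0, ← mul_assoc, ← ENNReal.ofReal_mul (by positivity)] at hpow
  have hLp : 0 < (L / 2) ^ p := by positivity
  calc ∫⁻ x in E, w x
      ≤ ENNReal.ofReal (C.toReal ^ p * K ^ p) * I / ENNReal.ofReal ((L / 2) ^ p) := by
        rw [ENNReal.le_div_iff_mul_le (Or.inl (by simpa using hLp))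
          (Or.inl ENNReal.ofReal_ne_top), mul_comm]
        exact hpow
    _ = ENNReal.ofReal (C.toReal ^ p * K ^ p / (L / 2) ^ p) * I := by
        rw [ENNReal.ofReal_div_of_pos hLp, ENNReal.mul_div_right_comm]
    _ ≤ ENNReal.ofReal (((2 * C.toReal * K) ^ p + 1) / L ^ p) * I := by
        gcongr ENNReal.ofReal ?_ * I
        rw [Real.div_rpow hL0.le (by norm_num), Real.mul_rpow (by positivity) hK0.le,
          Real.mul_rpow (by norm_num) ENNReal.toReal_nonneg, div_div_eq_mul_div]
        gcongr
        linarith
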